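/- Let k be an algebraically closed field of characteristic p = 3 and let R = k⟦x,y,z⟧/(z^2 + x^3 + y^5) (the rational double point of type E_8^0 in characteristic 3). Let τ := the Teichmüller lift of z/(xy) in 𝕎L, and let N_2 ⊆ 𝕎L be as in the context (with l = 2). Then: (i) F(τ) ∈ N_2; (ii) τ ∉ N_2; (iii) V(τ) ∉ N_2. Equivalently, the class of the length-2 Teichmüller lift of z/(xy) in H^2_m(R, W_2O) is nonzero, is annihilated by Frobenius, and is not annihilated by Verschiebung; this realizes the relations F ≡ V^2 ≡ 0 on the generator f_1^{(2)} of the Dieudonné module lim_{m,l} H^2_m(R, W_l O)[F^m], which has length 2 for E_8^0 in characteristic 3. -/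

import Mathlib

set_option maxHeartbeats 1000000
set_option synthInstance.maxHeartbeats 400000

open MvPowerSeries

noncomputable section

variable (k : Type) [Field k]

/-- The formal power series ring `k⟦x,y,z⟧`. -/
abbrev PS := MvPowerSeries (Fin 3) k

/-- The hypersurface singularity `R = k⟦x,y,z⟧/(f)`. -/
abbrev Rq (f : PS k) : Type := PS k ⧸ Ideal.span {f}

/-- The image of `x` in `R`. -/
abbrev xR (f : PS k) : Rq k f := Ideal.Quotient.mk _ (X 0)
/-- The image of `y` in `R`. -/
abbrev yR (f : PS k) : Rq k f := Ideal.Quotient.mk _ (X 1)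
/-- The image of `z` in `R`. -/
abbrev zR (f : PS k) : Rq k f := Ideal.Quotient.mk _ (X 2)

/-- `L`: the localization of `R` inverting `x*y`. -/
abbrev Lloc (f : PS k) : Type := Localization.Away (xR k f * yR k f)

/-- The canonical map from the localization of `R` inverting `x` to `L`. -/
noncomputable def phiX (f : PS k) : Localization.Away (xR k f) →+* Lloc k f :=
  IsLocalization.Away.awayToAwayRight (S := Localization.Away (xR k f)) (P := Lloc k f)
    (xR k f) (yR k f)

/-- The canonical map from the localization of `R` inverting `y` to `L`. -/
noncomputable def phiY (f : PS k) : Localization.Away (yR k f) →+* Lloc k f :=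
  IsLocalization.Away.awayToAwayLeft (S := Localization.Away (yR k f)) (P := Lloc k f)
    (yR k f) (xR k f)

/-- `A ⊆ L`: the `R`-submodule generated by the images of `R_x` and `R_y` in `L`.
The quotient `L/A` is a Čech description of the local cohomology `H^2_m(R)`. -/
def Asub (f : PS k) : Submodule (Rq k f) (Lloc k f) :=
  Submodule.span (Rq k f) (Set.range (phiX k f) ∪ Set.range (phiY k f))

/-- The element `z/(x*y) ∈ L`. -/
noncomputable def zxy (f : PS k) : Lloc k f :=
  Localization.mk (zR k f) ⟨xR k f * yR k f, Submonoid.mem_powers _⟩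

/-- The element `f_j := z/(x*y^j) = z*x^(j-1)/(x*y)^j ∈ L` (for `j ≥ 1`). -/
noncomputable def fcls (f : PS k) (j : ℕ) : Lloc k f :=
  Localization.mk (zR k f * xR k f ^ (j - 1)) ⟨(xR k f * yR k f) ^ j, j, rfl⟩

/-- `N_l ⊆ 𝕎L`: the additive subgroup generated by the images of the Witt vectors of the
localizations of `R` inverting `x` and inverting `y`, together with the image of `V^l`.
The quotient `𝕎L/N_l` is a Čech description of the local cohomology `H^2_m(R, W_lO)`. -/
def Nsub (p : ℕ) [Fact p.Prime] (f : PS k) (l : ℕ) : AddSubgroup (WittVector p (Lloc k f)) :=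
  AddSubgroup.closure
    (Set.range (WittVector.map (p := p) (phiX k f) :
        WittVector p (Localization.Away (xR k f)) → WittVector p (Lloc k f)) ∪
      Set.range (WittVector.map (p := p) (phiY k f) :
        WittVector p (Localization.Away (yR k f)) → WittVector p (Lloc k f)) ∪
      Set.range ((⇑(WittVector.verschiebung (p := p) (R := Lloc k f)))^[l]))

instance : Fact (Nat.Prime 3) := ⟨by norm_num⟩

/-- The defining equation of the rational double point of type `E_8^0` in characteristic `3`. -/
abbrev fE8p0 : PS k := X 2 ^ 2 + X 0 ^ 3 + X 1 ^ 5

section Witt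

open WittVector

variable {A : Type*} [CommRing A]

theorem eq_teichmuller_add_verschiebung_shift {p : ℕ} [Fact p.Prime] (x : WittVector p A) :
    x = teichmuller p (x.coeff 0) + verschiebung (x.shift 1) := by
  ext n
  rw [coeff_add_of_disjoint]
  · rcases n with _ | n
    · simp
    · rw [teichmuller_coeff_pos _ _ _ n.succ_pos, verschiebung_coeff_succ, zero_add, shift_coeff,
        add_comm]
  · rintro (_ | n)
    · exact Or.inr (verschiebung_coeff_zero _)
    · exact Or.inl (teichmuller_coeff_pos _ _ _ n.succ_pos)

theorem coeff_one_teichmuller_add_teichmuller (a b : A) :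
    (teichmuller 3 a + teichmuller 3 b).coeff 1 = -(a ^ 2 * b + a * b ^ 2) := by
  let P := MvPolynomial (Fin 2) ℤ
  have key : (teichmuller 3 (MvPolynomial.X 0 : P) + teichmuller 3 (MvPolynomial.X 1 : P)).coeff 1
      = -((MvPolynomial.X 0) ^ 2 * MvPolynomial.X 1 + MvPolynomial.X 0 * MvPolynomial.X 1 ^ 2) := by
    have h := map_add (ghostComponent (p := 3) 1) (teichmuller 3 (MvPolynomial.X 0 : P))
      (teichmuller 3 (MvPolynomial.X 1 : P))
    rw [ghostComponent_teichmuller, ghostComponent_teichmuller, ghostComponent_apply,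
      wittPolynomial_one] at h
    simp only [map_add, map_mul, map_pow, MvPolynomial.aeval_X, MvPolynomial.aeval_C,
      add_coeff_zero, teichmuller_coeff_zero] at h
    have h3 : (3 : P) ≠ 0 := by
      have : ((3 : ℕ) : P) ≠ 0 := Nat.cast_ne_zero.mpr (by norm_num)
      exact_mod_cast this
    apply mul_left_cancel₀ h3
    push_cast at h
    simp only [map_ofNat] at h
    linear_combination h
  have := congrArg (MvPolynomial.eval₂Hom (Int.castRingHom A) ![a, b]) key
  rw [← WittVector.map_coeff, map_add, map_teichmuller, map_teichmuller] at this
  simpa using this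

theorem exists_teichmuller_add_teichmuller (a b : A) : ∃ y : WittVector 3 A,
    teichmuller 3 a + teichmuller 3 b = teichmuller 3 (a + b) + verschiebung y ∧
      y.coeff 0 = -(a ^ 2 * b + a * b ^ 2) := by
  refine ⟨(teichmuller 3 a + teichmuller 3 b).shift 1, ?_, ?_⟩
  · conv_lhs => rw [eq_teichmuller_add_verschiebung_shift (teichmuller 3 a + teichmuller 3 b)]
    simp [add_coeff_zero]
  · rw [shift_coeff]
    exact coeff_one_teichmuller_add_teichmuller a b

theorem eq_verschiebung_of_coeff_zero {p : ℕ} [Fact p.Prime] {x : WittVector p A}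
    (h : x.coeff 0 = 0) : ∃ y, x = verschiebung y := by
  refine ⟨x.shift 1, ?_⟩
  conv_lhs => rw [eq_teichmuller_add_verschiebung_shift x, h, teichmuller_zero, zero_add]

theorem mem_Nsub_iff {p : ℕ} [Fact p.Prime] {f : PS k} {l : ℕ} {w : WittVector p (Lloc k f)} :
    w ∈ Nsub k p f l ↔ ∃ a b c, w = WittVector.map (phiX k f) a + WittVector.map (phiY k f) b +
      verschiebung^[l] c := by
  constructor
  · intro h
    induction h using AddSubgroup.closure_induction with
    | mem x hx =>
      rcases hx with (⟨a, rfl⟩ | ⟨b, rfl⟩) | ⟨c, rfl⟩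
      · exact ⟨a, 0, 0, by simp [iterate_map_zero]⟩
      · exact ⟨0, b, 0, by simp [iterate_map_zero]⟩
      · exact ⟨0, 0, c, by simp⟩
    | zero => exact ⟨0, 0, 0, by simp [iterate_map_zero]⟩
    | add x y _ _ hx hy =>
      obtain ⟨a, b, c, rfl⟩ := hx
      obtain ⟨a', b', c', rfl⟩ := hy
      exact ⟨a + a', b + b', c + c', by simp only [iterate_map_add, map_add]; abel⟩
    | neg x _ hx =>
      obtain ⟨a, b, c, rfl⟩ := hx
      exact ⟨-a, -b, -c, by simp only [iterate_map_neg, map_neg]; abel⟩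
  · rintro ⟨a, b, c, rfl⟩
    exact add_mem (add_mem (AddSubgroup.subset_closure (.inl (.inl ⟨a, rfl⟩)))
      (AddSubgroup.subset_closure (.inl (.inr ⟨b, rfl⟩))))
      (AddSubgroup.subset_closure (.inr ⟨c, rfl⟩))

theorem exists_of_teichmuller_mem_Nsub {f : PS k} {w : Lloc k f}
    (h : teichmuller 3 w ∈ Nsub k 3 f 2) : ∃ a b, w = phiX k f a + phiY k f b := by
  obtain ⟨a, b, c, h⟩ := (mem_Nsub_iff k).mp h
  refine ⟨a.coeff 0, b.coeff 0, ?_⟩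
  have := congrArg (fun x => x.coeff 0) h
  simpa [add_coeff_zero, WittVector.map_coeff] using this

theorem exists_of_verschiebung_teichmuller_mem_Nsub {f : PS k} {w : Lloc k f}
    (h : verschiebung (teichmuller 3 w) ∈ Nsub k 3 f 2) :
    ∃ a b, w = phiX k f a + phiY k f b := by
  obtain ⟨a, b, c, h⟩ := (mem_Nsub_iff k).mp h
  have h0 : phiX k f (a.coeff 0) + phiY k f (b.coeff 0) = 0 := by
    have := congrArg (fun x => x.coeff 0) h
    simpa [add_coeff_zero, WittVector.map_coeff] using this.symm
  rw [eq_teichmuller_add_verschiebung_shift a, eq_teichmuller_add_verschiebung_shift b] at h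
  obtain ⟨y, hy, hy0⟩ := exists_teichmuller_add_teichmuller
    (phiX k f (a.coeff 0)) (phiY k f (b.coeff 0))
  rw [h0, teichmuller_zero, zero_add] at hy
  have hy0' : y.coeff 0 = 0 := by
    rw [hy0]
    linear_combination -(phiX k f (a.coeff 0)) * (phiY k f (b.coeff 0)) * h0
  simp only [map_add, map_teichmuller, map_verschiebung] at h
  have h' : verschiebung (teichmuller 3 w) = verschiebung (y + WittVector.map (phiX k f) (a.shift 1)
      + WittVector.map (phiY k f) (b.shift 1) + verschiebung c) := by
    rw [h, map_add, map_add, map_add, ← hy]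
    simp only [Function.iterate_succ, Function.iterate_zero, Function.comp, id]
    abel
  have := congrArg (fun x => x.coeff 0) (verschiebung_injective 3 _ h')
  refine ⟨(a.shift 1).coeff 0, (b.shift 1).coeff 0, ?_⟩
  simpa [add_coeff_zero, WittVector.map_coeff, hy0'] using this

theorem teichmuller_mem_Nsub {f : PS k} {w : Lloc k f} (a b a' b')
    (h : w = phiX k f a + phiY k f b)
    (h' : phiX k f a ^ 2 * phiY k f b + phiX k f a * phiY k f b ^ 2 =
      phiX k f a' + phiY k f b') :
    teichmuller 3 w ∈ Nsub k 3 f 2 := by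
  obtain ⟨y, hy, hy0⟩ := exists_teichmuller_add_teichmuller (phiX k f a) (phiY k f b)
  obtain ⟨c, hc⟩ : ∃ c, y + teichmuller 3 (phiX k f a') + teichmuller 3 (phiY k f b') =
      verschiebung c := by
    apply eq_verschiebung_of_coeff_zero
    rw [add_coeff_zero, add_coeff_zero, hy0, teichmuller_coeff_zero, teichmuller_coeff_zero, h']
    ring
  rw [mem_Nsub_iff]
  refine ⟨teichmuller 3 a + verschiebung (teichmuller 3 a'),
    teichmuller 3 b + verschiebung (teichmuller 3 b'), -c, ?_⟩
  have hV := congrArg (verschiebung : WittVector 3 (Lloc k f) →+ _) hc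
  simp only [map_add] at hV
  simp only [Function.iterate_succ, Function.iterate_zero, Function.comp, id, map_neg, ← hV]
  simp only [map_add, map_teichmuller, map_verschiebung]
  rw [h, eq_sub_of_add_eq hy.symm]
  abel

end Witt

section Cech

theorem phiX_algebraMap (f : PS k) (r : Rq k f) :
    phiX k f (algebraMap _ _ r) = algebraMap _ _ r :=
  IsLocalization.Away.awayToAwayRight_eq _ _ _

theorem phiY_algebraMap (f : PS k) (r : Rq k f) :
    phiY k f (algebraMap _ _ r) = algebraMap _ _ r :=
  IsLocalization.Away.awayToAwayLeft_eq _ _ _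

theorem zxy_mul (f : PS k) : zxy k f * (algebraMap _ _ (xR k f) * algebraMap _ _ (yR k f)) =
    algebraMap _ _ (zR k f) := by
  refine (congrArg (zxy k f * ·) (map_mul (algebraMap (Rq k f) (Lloc k f)) _ _).symm).trans ?_
  refine (congrArg (· * _) (Localization.mk_eq_mk'_apply _ _)).trans ?_
  exact IsLocalization.mk'_spec (Lloc k f) (zR k f) (⟨xR k f * yR k f, Submonoid.mem_powers _⟩ :
    Submonoid.powers (xR k f * yR k f))

theorem exists_of_zxy_eq {f : PS k} {a b} (h : zxy k f = phiX k f a + phiY k f b) :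
    ∃ (m n : ℕ) (r s t : PS k), X 2 * X 0 ^ m * X 1 ^ n =
      X 0 ^ (m + 1) * r + X 1 ^ (n + 1) * s + t * f := by
  obtain ⟨m, r, hr⟩ := IsLocalization.Away.surj (xR k f) a
  obtain ⟨n, s, hs⟩ := IsLocalization.Away.surj (yR k f) b
  replace hr := congrArg (phiX k f) hr
  replace hs := congrArg (phiY k f) hs
  simp only [map_mul, map_pow, phiX_algebraMap, phiY_algebraMap] at hr hs
  have hz := zxy_mul k f
  have key : algebraMap (Rq k f) (Lloc k f) (zR k f * xR k f ^ m * yR k f ^ n) =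
      algebraMap (Rq k f) (Lloc k f) (xR k f * yR k f ^ (n + 1) * r
        + xR k f ^ (m + 1) * yR k f * s) := by
    simp only [map_mul, map_pow, map_add, ← hz, ← hr, ← hs, h]
    ring
  obtain ⟨N, hN⟩ := IsLocalization.Away.exists_of_eq (xR k f * yR k f) key
  obtain ⟨r, rfl⟩ := Ideal.Quotient.mk_surjective r
  obtain ⟨s, rfl⟩ := Ideal.Quotient.mk_surjective s
  simp only [xR, yR, zR, ← map_mul, ← map_pow, ← map_add] at hN
  rw [Ideal.Quotient.eq, Ideal.mem_span_singleton'] at hN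
  obtain ⟨t, ht⟩ := hN
  refine ⟨N + m, N + n, X 1 ^ (N + 1) * s, X 0 ^ (N + 1) * r, t, ?_⟩
  linear_combination -ht

/-- The exponent vector of the monomial `x ^ i * y ^ j * z ^ m`. -/
abbrev expo (i j m : ℕ) : Fin 3 →₀ ℕ := Finsupp.equivFunOnFinite.symm ![i, j, m]

theorem expo_le_iff {i j m i' j' m' : ℕ} :
    expo i j m ≤ expo i' j' m' ↔ i ≤ i' ∧ j ≤ j' ∧ m ≤ m' := by
  simp [Finsupp.le_def, Fin.forall_fin_succ]

theorem expo_sub {i j m i' j' m' : ℕ} :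
    expo i j m - expo i' j' m' = expo (i - i') (j - j') (m - m') := by
  ext s
  fin_cases s <;> simp

theorem coeff_X_pow_mul_expo (a b c i j m : ℕ) (g : PS k) :
    coeff (expo i j m) (X 0 ^ a * X 1 ^ b * X 2 ^ c * g) =
      if a ≤ i ∧ b ≤ j ∧ c ≤ m then coeff (expo (i - a) (j - b) (m - c)) g else 0 := by
  have : (X 0 ^ a * X 1 ^ b * X 2 ^ c : PS k) = monomial (expo a b c) 1 := by
    rw [X_pow_eq, X_pow_eq, X_pow_eq, monomial_mul_monomial, monomial_mul_monomial, mul_one,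
      mul_one]
    congr 1
    congr 1
    ext s
    fin_cases s <;> simp
  rw [this, coeff_monomial_mul, one_mul]
  simp only [expo_le_iff, expo_sub]

theorem coeff_monomial_expo (a b c i j m : ℕ) :
    coeff (expo i j m) (X 0 ^ a * X 1 ^ b * X 2 ^ c : PS k) =
      if a = i ∧ b = j ∧ c = m then 1 else 0 := by
  have h := coeff_X_pow_mul_expo k a b c i j m 1
  rw [mul_one] at h
  rw [h, coeff_one, ← ite_and]
  congr 1
  rw [eq_iff_iff]
  constructor
  · rintro ⟨h1, h2⟩
    have e0 := DFunLike.congr_fun h2 0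
    have e1 := DFunLike.congr_fun h2 1
    have e2 := DFunLike.congr_fun h2 2
    simp at e0 e1 e2
    omega
  · rintro ⟨rfl, rfl, rfl⟩
    refine ⟨by simp, ?_⟩
    ext s
    fin_cases s <;> simp

theorem monomial_ne_of_fE8p0 (m n : ℕ) (r s t : PS k) :
    X 2 * X 0 ^ m * X 1 ^ n ≠ X 0 ^ (m + 1) * r + X 1 ^ (n + 1) * s + t * fE8p0 k := by
  intro h
  have hrec : ∀ i j l : ℕ, i ≤ m → j ≤ n →
      (if m = i ∧ n = j ∧ 1 = l then 1 else 0) =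
        (if 2 ≤ l then coeff (expo i j (l - 2)) t else 0) +
        (if 3 ≤ i then coeff (expo (i - 3) j l) t else 0) +
        (if 5 ≤ j then coeff (expo i (j - 5) l) t else 0) := by
    intro i j l hi hj
    have h' : (X 0 ^ m * X 1 ^ n * X 2 ^ 1 : PS k) =
        X 0 ^ (m + 1) * X 1 ^ 0 * X 2 ^ 0 * r + X 0 ^ 0 * X 1 ^ (n + 1) * X 2 ^ 0 * s +
        (X 0 ^ 0 * X 1 ^ 0 * X 2 ^ 2 * t + X 0 ^ 3 * X 1 ^ 0 * X 2 ^ 0 * t +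
          X 0 ^ 0 * X 1 ^ 5 * X 2 ^ 0 * t) := by
      linear_combination h
    have hc := congrArg (coeff (expo i j l)) h'
    simp only [map_add, coeff_X_pow_mul_expo, coeff_monomial_expo] at hc
    rw [hc, if_neg (by omega), if_neg (by omega)]
    simp [add_assoc]
  have vanish : ∀ d i j l : ℕ, i + j = d → i ≤ m → j ≤ n → coeff (expo i j l) t = 0 := by
    intro d
    induction d using Nat.strong_induction_on with
    | _ d ih =>
      intro i j l hd hi hj
      have hr := hrec i j (l + 2) hi hj
      rw [if_neg (by omega), if_pos (by omega)] at hr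
      have h1 : (if 3 ≤ i then coeff (expo (i - 3) j (l + 2)) t else 0) = 0 := by
        split_ifs
        · exact ih (i - 3 + j) (by omega) _ _ _ rfl (by omega) hj
        · rfl
      have h2 : (if 5 ≤ j then coeff (expo i (j - 5) (l + 2)) t else 0) = 0 := by
        split_ifs
        · exact ih (i + (j - 5)) (by omega) _ _ _ rfl hi (by omega)
        · rfl
      rw [h1, h2] at hr
      simpa using hr.symm
  have hr := hrec m n 1 le_rfl le_rfl
  rw [vanish _ (m - 3) n 1 rfl (by omega) le_rfl, vanish _ m (n - 5) 1 rfl le_rfl (by omega)] at hr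
  simp at hr

theorem zxy_fE8p0_ne (a b) : zxy k (fE8p0 k) ≠ phiX k (fE8p0 k) a + phiY k (fE8p0 k) b := by
  intro h
  obtain ⟨m, n, r, s, t, h⟩ := exists_of_zxy_eq k h
  exact monomial_ne_of_fE8p0 k m n r s t h

theorem three_eq_zero_Lloc [CharP k 3] (f : PS k) : (3 : Lloc k f) = 0 := by
  have h : (3 : k) = 0 := by exact_mod_cast CharP.cast_eq_zero k 3
  have := congrArg (algebraMap (Rq k f) (Lloc k f))
    (congrArg (Ideal.Quotient.mk (Ideal.span {f})) (congrArg (C (σ := Fin 3)) h))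
  simpa only [map_ofNat, map_zero] using this

theorem frobeniusFun_teichmuller_of_three_eq_zero {A : Type*} [CommRing A] (h3 : (3 : A) = 0)
    (a : A) : WittVector.frobeniusFun (WittVector.teichmuller 3 a) =
      WittVector.teichmuller 3 (a ^ 3) := by
  rcases subsingleton_or_nontrivial A with _ | _
  · ext n
    exact Subsingleton.elim _ _
  · obtain ⟨c, hc⟩ := CharP.exists A
    have hdvd : c ∣ 3 := (CharP.cast_eq_zero_iff A c 3).mp (by exact_mod_cast h3)
    obtain rfl | rfl := (Nat.dvd_prime Nat.prime_three).mp hdvd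
    · exact absurd rfl (CharP.char_ne_one A 1)
    · change WittVector.frobenius _ = _
      rw [WittVector.frobenius_eq_map_frobenius, WittVector.map_teichmuller, frobenius_def]

theorem teichmuller_zxy_pow_mem_Nsub :
    WittVector.teichmuller 3 (zxy k (fE8p0 k) ^ 3) ∈ Nsub k 3 (fE8p0 k) 2 := by
  set f := fE8p0 k with hf
  set x := algebraMap (Rq k f) (Lloc k f) (xR k f) with hx
  set y := algebraMap (Rq k f) (Lloc k f) (yR k f) with hy
  set z := algebraMap (Rq k f) (Lloc k f) (zR k f) with hz
  let u' := IsLocalization.Away.invSelf (S := Localization.Away (xR k f)) (xR k f)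
  let v' := IsLocalization.Away.invSelf (S := Localization.Away (yR k f)) (yR k f)
  set u := phiX k f u' with hu
  set v := phiY k f v' with hv
  have hxu : x * u = 1 := by
    rw [hx, hu, ← phiX_algebraMap, ← map_mul, IsLocalization.Away.mul_invSelf, map_one]
  have hyv : y * v = 1 := by
    rw [hy, hv, ← phiY_algebraMap, ← map_mul, IsLocalization.Away.mul_invSelf, map_one]
  have hw : zxy k f = z * u * v := by
    rw [hz, ← zxy_mul k f, ← hx, ← hy]
    linear_combination -(zxy k f * x * u) * hyv - zxy k f * hxu
  have hfz : z ^ 2 = -(x ^ 3 + y ^ 5) := by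
    have h0 : (Ideal.Quotient.mk (Ideal.span {f})) f = 0 :=
      Ideal.Quotient.eq_zero_iff_mem.mpr (Ideal.mem_span_singleton_self f)
    have h1 := congrArg (algebraMap (Rq k f) (Lloc k f)) h0
    conv at h1 => lhs; arg 2; arg 2; rw [hf]
    simp only [map_add, map_pow, map_zero] at h1
    linear_combination h1
  have e1 : phiX k f (-(algebraMap _ _ (zR k f * yR k f ^ 2) * u' ^ 3)) = -(z * y ^ 2 * u ^ 3) := by
    simp only [map_neg, map_mul, map_pow, phiX_algebraMap, hu, hz, hy]
  have e2 : phiY k f (-(algebraMap _ _ (zR k f) * v' ^ 3)) = -(z * v ^ 3) := by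
    simp only [map_neg, map_mul, map_pow, phiY_algebraMap, hv, hz]
  have e3 : phiX k f (algebraMap _ _ (2 * zR k f * yR k f) * u' ^ 3 +
      algebraMap _ _ (zR k f * yR k f ^ 6) * u' ^ 6) = 2 * z * y * u ^ 3 + z * y ^ 6 * u ^ 6 := by
    simp only [map_add, map_mul, map_pow, phiX_algebraMap, hu, hz, hy, map_ofNat]
  have e4 : phiY k f (algebraMap _ _ (zR k f) * v' ^ 4) = z * v ^ 4 := by
    simp only [map_mul, map_pow, phiY_algebraMap, hv, hz]
  have hxu3 : x ^ 3 * u ^ 3 = 1 := by rw [← mul_pow, hxu, one_pow]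
  have hyv2 : y ^ 2 * v ^ 2 = 1 := by rw [← mul_pow, hyv, one_pow]
  have hyv3 : y ^ 3 * v ^ 3 = 1 := by rw [← mul_pow, hyv, one_pow]
  refine teichmuller_mem_Nsub k (-(algebraMap _ _ (zR k f * yR k f ^ 2) * u' ^ 3))
    (-(algebraMap _ _ (zR k f) * v' ^ 3)) (algebraMap _ _ (2 * zR k f * yR k f) * u' ^ 3 +
      algebraMap _ _ (zR k f * yR k f ^ 6) * u' ^ 6) (algebraMap _ _ (zR k f) * v' ^ 4) ?_ ?_
  · rw [e1, e2, hw]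
    linear_combination z * u ^ 3 * v ^ 3 * hfz - z * v ^ 3 * hxu3 - z * y ^ 2 * u ^ 3 * hyv3
  · rw [e1, e2, e3, e4]
    linear_combination -z * (y ^ 4 * u ^ 6 * v ^ 3 + y ^ 2 * u ^ 3 * v ^ 6) * hfz
      + z * y * u ^ 3 * (y ^ 3 * v ^ 3 * hxu3 + hyv3) + z * v ^ 4 * (y ^ 2 * v ^ 2 * hxu3 + hyv2)
      + z * y ^ 6 * u ^ 6 * hyv3 + z * y * u ^ 3 * (y ^ 3 * v ^ 3 + 1) * hyv3

end Cech

/-- For the rational double point of type `E_8^0` in characteristic `3`,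
with `τ` the Teichmüller lift of `z/(xy)` in `𝕎L`: `F(τ) ∈ N₂`, `τ ∉ N₂` and `V(τ) ∉ N₂`;
i.e. the class of the length-2 Teichmüller lift of `z/(xy)` in `H^2_m(R, W₂O)` is nonzero,
is annihilated by Frobenius, and is not annihilated by Verschiebung. This realizes the
relations `F ≡ V² ≡ 0` on the generator `f₁⁽²⁾` of the Dieudonné module, which has length 2. -/
theorem wittLocalCohomology_E8p0_char3 (k : Type) [Field k] [IsAlgClosed k] [CharP k 3] :
    -- (i) F(τ) ∈ N₂
    WittVector.frobeniusFun (WittVector.teichmuller 3 (zxy k (fE8p0 k)))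
      ∈ Nsub k 3 (fE8p0 k) 2 ∧
    -- (ii) τ ∉ N₂
    WittVector.teichmuller 3 (zxy k (fE8p0 k)) ∉ Nsub k 3 (fE8p0 k) 2 ∧
    -- (iii) V(τ) ∉ N₂
    WittVector.verschiebung (WittVector.teichmuller 3 (zxy k (fE8p0 k)))
      ∉ Nsub k 3 (fE8p0 k) 2 := by
  refine ⟨?_, fun h => ?_, fun h => ?_⟩
  · rw [frobeniusFun_teichmuller_of_three_eq_zero (three_eq_zero_Lloc k _)]
    exact teichmuller_zxy_pow_mem_Nsub k
  · obtain ⟨a, b, h⟩ := exists_of_teichmuller_mem_Nsub k h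
    exact zxy_fE8p0_ne k a b h
  · obtain ⟨a, b, h⟩ := exists_of_verschiebung_teichmuller_mem_Nsub k h
    exact zxy_fE8p0_ne k a b h
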